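/- arXiv:1811.05376 — 2 statements merged into one kernel-verified Lean document; each statement's English description precedes it below -/
import Mathlib

section
/- There exists an entire function L : ℂ → ℂ such that L(s) = Σ_{m=1}^∞ C(m) m^{−s} for every s ∈ ℂ with Re(s) > 1 (the series converging absolutely there), and such that for every integer r ≥ 0, L(−r) = −(M^r/(r + 1)) · Σ_{m=1}^M C(m) B_{r+1}(m/M). -/
open scoped BigOperators

open Complex HurwitzZeta Filter Topology Set Asymptotics
open scoped Real

/-- If `‖w‖ ≤ 1` and `w ≠ 1`, then `1 - w` lies in the slit plane. -/
lemma one_sub_mem_slitPlane_of_norm_le_one {w : ℂ} (hw : ‖w‖ ≤ 1) (hw1 : w ≠ 1) :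
    1 - w ∈ slitPlane := by
  have h1 : w.re ≤ 1 := (re_le_norm w).trans hw
  rcases h1.lt_or_eq with h | h
  · exact Or.inl (by simpa using h)
  · exfalso
    apply hw1
    have h2 : ‖w‖ ^ 2 ≤ 1 := pow_le_one₀ (norm_nonneg _) hw
    rw [Complex.sq_norm, normSq_apply, h] at h2
    apply Complex.ext
    · simpa using h
    · simpa using (by nlinarith : w.im * w.im = 0)

lemma mul_exp_neg_ne_one {z : ℂ} (hz : ‖z‖ = 1) (hz1 : z ≠ 1) {t : ℝ} (ht : 0 ≤ t) :
    z * cexp (-t) ≠ 1 := by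
  rcases ht.eq_or_lt with rfl | ht
  · simpa using hz1
  · intro h
    have := congrArg norm h
    rw [norm_mul, hz, norm_exp] at this
    simp at this
    exact ht.ne' this

lemma norm_mul_exp_neg_le_one {z : ℂ} (hz : ‖z‖ = 1) {t : ℝ} (ht : 0 ≤ t) :
    ‖z * cexp (-t)‖ ≤ 1 := by
  rw [norm_mul, hz, norm_exp]
  simpa using ht

lemma hasDerivAt_log_one_sub_mul_exp_neg {z : ℂ} (hz : ‖z‖ = 1) (hz1 : z ≠ 1) {t : ℝ}
    (ht : 0 ≤ t) :
    HasDerivAt (fun u : ℝ ↦ log (1 - z * cexp (-u)))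
      (z * cexp (-t) / (1 - z * cexp (-t))) t := by
  have h : HasDerivAt (fun u : ℝ ↦ 1 - z * cexp (-u)) (z * cexp (-t)) t := by
    have h0 : HasDerivAt (fun u : ℝ ↦ -(u : ℂ)) (-1) t := (ofRealCLM.hasDerivAt (x := t)).neg
    convert! (h0.cexp.const_mul z).const_sub 1 using 1
    ring
  exact h.clog_real (one_sub_mem_slitPlane_of_norm_le_one (norm_mul_exp_neg_le_one hz ht)
    (mul_exp_neg_ne_one hz hz1 ht))

lemma tendsto_mul_exp_neg (z : ℂ) : Tendsto (fun t : ℝ ↦ z * cexp (-t)) atTop (𝓝 0) := by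
  have : Tendsto (fun t : ℝ ↦ ((Real.exp (-t) : ℝ) : ℂ)) atTop (𝓝 ((0 : ℝ) : ℂ)) :=
    (continuous_ofReal.tendsto 0).comp Real.tendsto_exp_neg_atTop_nhds_zero
  simpa using this.const_mul z

/-- The Mellin transform at `1` of the generating function of `n ↦ z ^ n`. -/
lemma mellin_geometric_one {z : ℂ} (hz : ‖z‖ = 1) (hz1 : z ≠ 1) :
    DifferentiableAt ℂ (mellin fun t : ℝ ↦ z * cexp (-t) / (1 - z * cexp (-t))) 1 ∧
      mellin (fun t : ℝ ↦ z * cexp (-t) / (1 - z * cexp (-t))) 1 = -log (1 - z) := by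
  set F : ℝ → ℂ := fun t ↦ z * cexp (-t) / (1 - z * cexp (-t)) with hF
  have hne {t : ℝ} (ht : 0 ≤ t) : 1 - z * cexp (-t) ≠ 0 :=
    sub_ne_zero.mpr (mul_exp_neg_ne_one hz hz1 ht).symm
  have hcont {t : ℝ} (ht : 0 ≤ t) : ContinuousAt F t :=
    ContinuousAt.div (by fun_prop) (by fun_prop) (hne ht)
  have hloc : MeasureTheory.LocallyIntegrableOn F (Ioi 0) :=
    ContinuousOn.locallyIntegrableOn
      (fun t ht ↦ (hcont (le_of_lt ht)).continuousWithinAt) measurableSet_Ioi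
  have htop : F =O[atTop] fun t ↦ Real.exp (-1 * t) := by
    have h1 : (fun t : ℝ ↦ z * cexp (-t)) =O[atTop] fun t ↦ Real.exp (-1 * t) := by
      refine IsBigO.of_bound 1 (Eventually.of_forall fun t ↦ ?_)
      rw [norm_mul, hz, norm_exp]
      simp
    have h2 : (fun t : ℝ ↦ (1 - z * cexp (-t))⁻¹) =O[atTop] fun _ ↦ (1 : ℝ) := by
      refine Tendsto.isBigO_one ℝ (((tendsto_mul_exp_neg z).const_sub 1).inv₀ (by simp))
    simpa [hF, div_eq_mul_inv] using h1.mul h2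
  have hbot : F =O[𝓝[>] 0] fun t : ℝ ↦ t ^ (-(0 : ℝ)) := by
    simpa using ((hcont le_rfl).tendsto.mono_left nhdsWithin_le_nhds).isBigO_one ℝ
  refine ⟨mellin_differentiableAt_of_isBigO_rpow_exp one_pos hloc htop hbot (by simp), ?_⟩
  have hconv : MellinConvergent F 1 :=
    mellinConvergent_of_isBigO_rpow_exp one_pos hloc htop hbot (by simp)
  have hFint : MeasureTheory.IntegrableOn F (Ioi 0) := by
    simpa [MellinConvergent] using hconv
  have hlim : Tendsto (fun u : ℝ ↦ log (1 - z * cexp (-u))) atTop (𝓝 0) := by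
    have := ((tendsto_mul_exp_neg z).const_sub 1).clog (by simp)
    simpa using this
  have := MeasureTheory.integral_Ioi_of_hasDerivAt_of_tendsto'
    (fun t ht ↦ hasDerivAt_log_one_sub_mul_exp_neg hz hz1 ht) hFint hlim
  simpa [mellin] using this

/-- For `1 < re s`, `Γ(s)` times the exponential zeta function is a Mellin transform. -/
lemma Gamma_mul_expZeta_eq_mellin (x : ℝ) {s : ℂ} (hs : 1 < s.re) :
    Gamma s * expZeta x s =
      mellin (fun t : ℝ ↦ cexp (2 * π * I * x) * cexp (-t) /
        (1 - cexp (2 * π * I * x) * cexp (-t))) s := by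
  set z := cexp (2 * π * I * x) with hzdef
  have hz : ‖z‖ = 1 := by
    rw [hzdef, norm_exp]; simp
  have h1 := hasSum_mellin (a := fun n : ℕ ↦ z ^ (n + 1)) (p := fun n : ℕ ↦ (n + 1 : ℝ))
    (F := fun t : ℝ ↦ z * cexp (-t) / (1 - z * cexp (-t))) (s := s)
    (fun n ↦ Or.inr (by positivity)) (by linarith) ?_ ?_
  · refine HasSum.unique ?_ h1
    have h2 := (hasSum_expZeta_of_one_lt_re x hs).mul_left (Gamma s)
    rw [← hasSum_nat_add_iff' 1] at h2
    convert! h2 using 1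
    · ext n
      rw [hzdef, ← Complex.exp_nat_mul]
      push_cast
      ring_nf
    · simp [zero_cpow (ne_zero_of_one_lt_re hs)]
  · intro t ht
    have hlt : ‖z * cexp (-t)‖ < 1 := by
      rw [norm_mul, hz, norm_exp]
      simpa using ht
    convert! (hasSum_geometric_of_norm_lt_one hlt).mul_left (z * cexp (-t)) using 1
    ext n
    rw [← pow_succ', mul_pow, ← Complex.exp_nat_mul (-(t : ℂ))]
    push_cast
    ring_nf
  · simp only [norm_pow, hz, one_pow]
    have := (summable_nat_add_iff 1).mpr (Real.summable_one_div_nat_rpow.mpr hs)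
    simpa using this

/-- The exponential zeta function at `1`. -/
lemma expZeta_one {x : ℝ} (hx : (x : UnitAddCircle) ≠ 0) (hz1 : cexp (2 * π * I * x) ≠ 1) :
    expZeta x 1 = -log (1 - cexp (2 * π * I * x)) := by
  have hz : ‖cexp (2 * π * I * x)‖ = 1 := by rw [norm_exp]; simp
  obtain ⟨hd, hval⟩ := mellin_geometric_one hz hz1
  have hcurve : Tendsto (fun u : ℝ ↦ (u : ℂ)) (𝓝[>] 1) (𝓝 1) :=
    (continuous_ofReal.tendsto 1).mono_left nhdsWithin_le_nhds
  have hL : Tendsto (fun s : ℂ ↦ Gamma s * expZeta x s) (𝓝 1) (𝓝 (Gamma 1 * expZeta x 1)) := by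
    refine ContinuousAt.mul ?_ (differentiable_expZeta_of_ne_zero hx 1).continuousAt
    refine (differentiableAt_Gamma 1 fun m h ↦ ?_).continuousAt
    have := congrArg re h
    simp at this
    linarith [(m.cast_nonneg : (0 : ℝ) ≤ m)]
  rw [← hval]
  have key := tendsto_nhds_unique_of_eventuallyEq (hL.comp hcurve)
    (hd.continuousAt.tendsto.comp hcurve) ?_
  · simpa using key
  · filter_upwards [self_mem_nhdsWithin] with u hu
    exact Gamma_mul_expZeta_eq_mellin x (by simpa using hu)

lemma log_one_sub_exp_sub_log_one_sub_exp_neg {x : ℝ} (hx : x ∈ Ioo (0 : ℝ) 1) :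
    log (1 - cexp (2 * π * I * x)) - log (1 - cexp (2 * π * I * (-x : ℝ))) =
      2 * I * (π * (x - 1 / 2)) := by
  have hsin : 0 < 2 * Real.sin (π * x) :=
    mul_pos two_pos (Real.sin_pos_of_pos_of_lt_pi (mul_pos Real.pi_pos hx.1)
      (by nlinarith [Real.pi_pos, hx.2]))
  have hexp : ∀ y : ℝ, 1 - cexp (2 * π * I * y) =
      ((2 * Real.sin (π * y) : ℝ) : ℂ) * cexp ((π * (y - 1 / 2) : ℝ) * I) := by
    intro y
    have hI : cexp (-(π / 2 * I)) = -I := by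
      rw [Complex.exp_neg, exp_pi_div_two_mul_I, inv_I]
    have e1 : ((π * (y - 1 / 2) : ℝ) : ℂ) * I = π * y * I + -(π / 2 * I) := by
      push_cast; ring
    have e2 : (2 * π * I * y : ℂ) = π * y * I + π * y * I := by ring
    rw [e1, e2, Complex.exp_add, Complex.exp_add, hI]
    push_cast
    rw [Complex.sin]
    have e3 : cexp (-(π * y) * I) * cexp (π * y * I) = 1 := by
      rw [← Complex.exp_add]; simp
    linear_combination (-1 : ℂ) * e3 +
      (cexp (-(π * y) * I) - cexp (π * y * I)) * cexp (π * y * I) * I_sq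
  have h1 : log (1 - cexp (2 * π * I * x)) =
      Real.log (2 * Real.sin (π * x)) + (π * (x - 1 / 2) : ℝ) * I := by
    rw [hexp x, log_ofReal_mul hsin (Complex.exp_ne_zero _), log_exp] <;>
    · simp
      nlinarith [Real.pi_pos, hx.1, hx.2]
  have h2 : log (1 - cexp (2 * π * I * (-x : ℝ))) =
      Real.log (2 * Real.sin (π * x)) - (π * (x - 1 / 2) : ℝ) * I := by
    have : 1 - cexp (2 * π * I * (-x : ℝ)) =
        ((2 * Real.sin (π * x) : ℝ) : ℂ) * cexp (-(π * (x - 1 / 2) : ℝ) * I) := by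
      have := congrArg (starRingEnd ℂ) (hexp x)
      rw [map_sub, map_mul, ← exp_conj, ← exp_conj] at this
      simp only [map_one, map_mul, conj_ofReal, conj_I, map_ofNat] at this
      convert! this using 3 <;> push_cast <;> ring
    rw [this, log_ofReal_mul hsin (Complex.exp_ne_zero _), log_exp]
    · ring
    all_goals
    · simp
      nlinarith [Real.pi_pos, hx.1, hx.2]
  rw [h1, h2]
  push_cast
  ring

lemma coe_unitAddCircle_ne_zero {x : ℝ} (hx : x ∈ Ioo (0 : ℝ) 1) : (x : UnitAddCircle) ≠ 0 := by
  intro h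
  obtain ⟨n, hn⟩ := (AddCircle.coe_eq_zero_iff (1 : ℝ)).mp h
  simp only [zsmul_eq_mul, mul_one] at hn
  subst hn
  have h1 : (0 : ℤ) < n := by exact_mod_cast hx.1
  have h2 : n < (1 : ℤ) := by exact_mod_cast hx.2
  omega

lemma exp_two_pi_mul_I_ne_one {x : ℝ} (hx : (x : UnitAddCircle) ≠ 0) :
    cexp (2 * π * I * x) ≠ 1 := by
  intro h
  obtain ⟨n, hn⟩ := Complex.exp_eq_one_iff.mp h
  apply hx
  refine (AddCircle.coe_eq_zero_iff (1 : ℝ)).mpr ⟨n, ?_⟩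
  have h2 : (2 * π * I : ℂ) * x = 2 * π * I * n := by rw [hn]; ring
  have h3 : (x : ℂ) = n := mul_left_cancel₀ two_pi_I_ne_zero h2
  simpa using (by exact_mod_cast h3.symm : (n : ℝ) = x)

lemma sinZeta_one {x : ℝ} (hx : x ∈ Ioo (0 : ℝ) 1) :
    sinZeta x 1 = π * (1 / 2 - x) := by
  have hx0 := coe_unitAddCircle_ne_zero hx
  have hx0' : ((-x : ℝ) : UnitAddCircle) ≠ 0 := by
    rw [AddCircle.coe_neg]; exact neg_ne_zero.mpr hx0
  rw [sinZeta_eq, ← AddCircle.coe_neg, expZeta_one hx0 (exp_two_pi_mul_I_ne_one hx0),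
    expZeta_one hx0' (exp_two_pi_mul_I_ne_one hx0')]
  rw [div_eq_iff (by simp)]
  linear_combination -log_one_sub_exp_sub_log_one_sub_exp_neg hx

/-- The Hurwitz zeta function at `0`, away from the integers. -/
lemma hurwitzZeta_apply_zero_of_mem_Ioo {x : ℝ} (hx : x ∈ Ioo (0 : ℝ) 1) :
    hurwitzZeta x 0 = 1 / 2 - x := by
  have hodd := hurwitzZetaOdd_one_sub (x : UnitAddCircle) (s := 1) (fun n h ↦ by
    have := congrArg re h
    simp at this
    linarith [(n.cast_nonneg : (0 : ℝ) ≤ n)])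
  rw [sub_self, sinZeta_one hx] at hodd
  rw [hurwitzZeta, hurwitzZetaEven_apply_zero, if_neg (coe_unitAddCircle_ne_zero hx), hodd]
  have hpi : (π : ℂ) ≠ 0 := ofReal_ne_zero.mpr Real.pi_ne_zero
  simp [cpow_neg_one]
  field_simp

/-- Values of the Hurwitz zeta function at non-positive integers, for parameter in `(0, 1]`. -/
lemma hurwitzZeta_neg_nat_eq_aeval_bernoulli {x : ℝ} (hx : x ∈ Ioc (0 : ℝ) 1) (r : ℕ) :
    hurwitzZeta x (-r) = -1 / (r + 1) *
      Polynomial.aeval (x : ℂ) (Polynomial.bernoulli (r + 1)) := by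
  rcases eq_or_ne r 0 with rfl | hr
  · have hB : Polynomial.aeval (x : ℂ) (Polynomial.bernoulli (0 + 1)) = (x : ℂ) - 1 / 2 := by
      simp [Polynomial.bernoulli_one]
    rw [hB]
    rcases hx.2.lt_or_eq with h | rfl
    · simp [hurwitzZeta_apply_zero_of_mem_Ioo ⟨hx.1, h⟩]
    · have : ((1 : ℝ) : UnitAddCircle) = 0 := AddCircle.coe_period 1
      rw [this]
      simp [hurwitzZeta_zero, riemannZeta_zero]
      norm_num
  · rw [hurwitzZeta_neg_nat hr ⟨hx.1.le, hx.2⟩, Polynomial.eval_map_algebraMap]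

/-- Summing over `1, …, M` is summing over `ZMod M`. -/
lemma sum_Icc_intCast_zmod {A : Type*} [AddCommMonoid A] (M : ℕ) [NeZero M] (f : ZMod M → A) :
    ∑ m ∈ Finset.Icc (1 : ℤ) M, f m = ∑ j : ZMod M, f j := by
  have hinj : InjOn (fun m : ℤ ↦ (m : ZMod M)) (Finset.Icc (1 : ℤ) M) := by
    intro a ha b hb hab
    simp only [Finset.coe_Icc, mem_Icc] at ha hb
    have hdvd := (ZMod.intCast_eq_intCast_iff_dvd_sub a b M).mp hab
    have := Int.eq_zero_of_abs_lt_dvd hdvd (by rw [abs_lt]; omega)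
    omega
  have hmaps : MapsTo (fun m : ℤ ↦ (m : ZMod M)) (Finset.Icc (1 : ℤ) M)
      (Finset.univ : Finset (ZMod M)) := fun _ _ ↦ by simp
  refine Finset.sum_nbij (fun m : ℤ ↦ (m : ZMod M)) hmaps hinj ?_ fun _ _ ↦ rfl
  exact Finset.surjOn_of_injOn_of_card_le _ hmaps hinj (by simp [ZMod.card])

theorem statement7 (M : ℕ) (hM : 0 < M) (C : ℤ → ℂ)
    (hper : ∀ m : ℤ, C (m + M) = C m)
    (hmean : ∑ m ∈ Finset.Icc (1 : ℤ) (M : ℤ), C m = 0) :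
    ∃ L : ℂ → ℂ, Differentiable ℂ L ∧
      (∀ s : ℂ, 1 < s.re →
        Summable (fun m : ℕ => ‖C ((m : ℤ) + 1) * ((m : ℂ) + 1) ^ (-s)‖) ∧
        HasSum (fun m : ℕ => C ((m : ℤ) + 1) * ((m : ℂ) + 1) ^ (-s)) (L s)) ∧
      ∀ r : ℕ, L (-(r : ℂ)) =
        -((M : ℂ) ^ r / ((r : ℂ) + 1)) *
          ∑ m ∈ Finset.Icc (1 : ℤ) (M : ℤ),
            C m * Polynomial.aeval ((m : ℂ) / (M : ℂ)) (Polynomial.bernoulli (r + 1)) := by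
  have : NeZero M := ⟨hM.ne'⟩
  let Φ : ZMod M → ℂ := fun j ↦ C j.val
  have hΦ (m : ℤ) : Φ m = C m := by
    simp only [Φ, ZMod.val_intCast]
    rw [Int.emod_def, mul_comm]
    exact Function.Periodic.sub_int_mul_eq hper _
  refine ⟨ZMod.LFunction Φ, ?_, fun s hs ↦ ?_, fun r ↦ ?_⟩
  · apply ZMod.differentiable_LFunction_of_sum_zero
    rw [← sum_Icc_intCast_zmod, ← hmean]
    exact Finset.sum_congr rfl fun m _ ↦ hΦ m
  · have hsum := ZMod.LSeriesSummable_of_one_lt_re Φ hs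
    have hterm : (fun m : ℕ ↦ C ((m : ℤ) + 1) * ((m : ℂ) + 1) ^ (-s)) =
        fun m : ℕ ↦ LSeries.term (Φ ·) s (m + 1) := by
      ext m
      rw [LSeries.term_of_ne_zero m.succ_ne_zero, cpow_neg, ← div_eq_mul_inv]
      have := hΦ ((m : ℤ) + 1)
      push_cast at this ⊢
      rw [this]
    have hshift : HasSum (fun m : ℕ ↦ LSeries.term (Φ ·) s (m + 1)) (ZMod.LFunction Φ s) := by
      rw [ZMod.LFunction_eq_LSeries Φ hs, hasSum_nat_add_iff (f := LSeries.term (Φ ·) s) 1]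
      simpa [LSeriesHasSum] using hsum.LSeriesHasSum
    rw [← hterm] at hshift
    exact ⟨hshift.summable.norm, hshift⟩
  · have hpow : (M : ℂ) ^ (-(-(r : ℂ))) = (M : ℂ) ^ r := by rw [neg_neg, cpow_natCast]
    rw [ZMod.LFunction, ← sum_Icc_intCast_zmod, hpow, Finset.mul_sum, Finset.mul_sum]
    refine Finset.sum_congr rfl fun m hm ↦ ?_
    rw [Finset.mem_Icc] at hm
    have hMR : (0 : ℝ) < M := by exact_mod_cast hM
    have hmem : (m / M : ℝ) ∈ Ioc (0 : ℝ) 1 :=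
      ⟨div_pos (by exact_mod_cast hm.1) hMR, (div_le_one hMR).mpr (by exact_mod_cast hm.2)⟩
    rw [hΦ, ZMod.toAddCircle_intCast, hurwitzZeta_neg_nat_eq_aeval_bernoulli hmem]
    push_cast
    ring
end

section
/- For every real k > 0, (1/(2πi)) ∫_{−∞}^{∞} F((1+i)s) · exp(−k s²/(4πP)) · (1+i) ds = ∫₀^∞ e^{−kt} · (1/(2πi)) · √(8πiP/t) · F(√(8πiP·t)) dt, where the square roots are principal branches; both integrals converge absolutely. -/
open scoped BigOperators
open MeasureTheory

/-- The function `F(y) = (1/4) · (∏_j sinh(y/(2 p_j))) / sinh(y/2)^(n−2)`. -/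
noncomputable def seifertF (n : ℕ) (p : Fin n → ℤ) (y : ℂ) : ℂ :=
  (1 / 4) * (∏ j, Complex.sinh (y / (2 * (p j : ℂ)))) / Complex.sinh (y / 2) ^ (n - 2)

open Complex in
/-- On the diagonal, `|sinh ((1 + i) x)|² = sinh² x + sin² x`. -/
lemma sq_norm_sinh_one_add_I_mul (x : ℝ) :
    ‖sinh ((1 + I) * x)‖ ^ 2 = Real.sinh x ^ 2 + Real.sin x ^ 2 := by
  have h : sinh ((1 + I) * x) =
      ((Real.sinh x * Real.cos x : ℝ) : ℂ) + ((Real.cosh x * Real.sin x : ℝ) : ℂ) * I := by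
    rw [add_mul, one_mul, mul_comm I, sinh_add, sinh_mul_I, cosh_mul_I]
    push_cast
    ring
  rw [h, Complex.sq_norm, normSq_add_mul_I]
  linear_combination Real.sin x ^ 2 * Real.cosh_sq x + Real.sinh x ^ 2 * Real.sin_sq_add_cos_sq x

/-- The sine is dominated by the hyperbolic sine. -/
lemma sin_sq_le_sinh_sq (x : ℝ) : Real.sin x ^ 2 ≤ Real.sinh x ^ 2 := by
  refine sq_le_sq.2 (Real.abs_sin_le_abs.trans ?_)
  rw [Real.abs_sinh]
  exact Real.self_le_sinh_iff.2 (abs_nonneg x)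

open Complex in
/-- Along the diagonal, shrinking the argument of `sinh` at most doubles its absolute value. -/
lemma norm_sinh_one_add_I_mul_le {x y : ℝ} (hxy : |x| ≤ |y|) :
    ‖sinh ((1 + I) * x)‖ ≤ 2 * ‖sinh ((1 + I) * y)‖ := by
  refine le_of_sq_le_sq ?_ (by positivity)
  rw [mul_pow, sq_norm_sinh_one_add_I_mul, sq_norm_sinh_one_add_I_mul]
  have h : Real.sinh x ^ 2 ≤ Real.sinh y ^ 2 := by
    rw [sq_le_sq, Real.abs_sinh, Real.abs_sinh]
    exact Real.sinh_le_sinh.2 hxy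
  nlinarith [sin_sq_le_sinh_sq x, sq_nonneg (Real.sin y), sq_nonneg (Real.sinh y)]

open Complex in
/-- Along the diagonal, `sinh` grows at most exponentially. -/
lemma sq_norm_sinh_one_add_I_mul_le_exp (x : ℝ) :
    ‖sinh ((1 + I) * x)‖ ^ 2 ≤ Real.exp (2 * |x|) := by
  have hsin := Real.sin_sq_le_one x
  have hcosh : Real.cosh x ≤ Real.exp |x| := by
    rw [← Real.cosh_abs, ← Real.cosh_add_sinh |x|]
    linarith [Real.sinh_nonneg_iff.2 (abs_nonneg x)]
  rw [sq_norm_sinh_one_add_I_mul, two_mul, Real.exp_add]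
  nlinarith [Real.cosh_sq x, Real.cosh_pos x]

open Complex in
/-- Along the diagonal, `F` grows at most exponentially. -/
lemma norm_seifertF_le {n : ℕ} (hn : 2 ≤ n) {p : Fin n → ℤ} (hp : ∀ j, 1 ≤ p j) (s : ℝ) :
    ‖seifertF n p ((1 + I) * s)‖ ≤ 2 ^ n * Real.exp |s| := by
  set D := ‖sinh ((1 + I) * s / 2)‖ with hD
  have hD' : D = ‖sinh ((1 + I) * ((s / 2 : ℝ) : ℂ))‖ := by
    rw [hD]; push_cast; rw [mul_div_assoc]
  have hfactor (j : Fin n) : ‖sinh ((1 + I) * s / (2 * (p j : ℂ)))‖ ≤ 2 * D := by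
    have hpj : (1 : ℝ) ≤ p j := by exact_mod_cast hp j
    have harg : (1 + I) * s / (2 * (p j : ℂ)) = (1 + I) * ((s / (2 * p j) : ℝ) : ℂ) := by
      push_cast; rw [mul_div_assoc]
    rw [harg, hD']
    refine norm_sinh_one_add_I_mul_le ?_
    rw [abs_div, abs_div, abs_of_pos (by positivity : (0 : ℝ) < 2 * p j), abs_two]
    gcongr
    linarith
  have hprod : ∏ j, ‖sinh ((1 + I) * s / (2 * (p j : ℂ)))‖ ≤ (2 * D) ^ n := by
    refine (Finset.prod_le_prod (fun _ _ => norm_nonneg _) fun j _ => hfactor j).trans ?_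
    simp
  have hD0 : 0 ≤ D := norm_nonneg _
  have hDexp : D ^ 2 ≤ Real.exp |s| := by
    rw [hD']
    refine (sq_norm_sinh_one_add_I_mul_le_exp _).trans_eq ?_
    rw [abs_div, abs_two]
    ring_nf
  have hdiv : (2 * D) ^ n / D ^ (n - 2) ≤ 2 ^ n * D ^ 2 := by
    refine div_le_of_le_mul₀ (by positivity) (by positivity) ?_
    rw [mul_assoc, ← pow_add, Nat.add_sub_cancel' hn, mul_pow]
  rw [seifertF, norm_div, norm_mul, norm_prod, norm_pow, ← hD]
  calc ‖(1 / 4 : ℂ)‖ * (∏ j, ‖sinh ((1 + I) * s / (2 * (p j : ℂ)))‖) / D ^ (n - 2)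
      ≤ 1 * (2 * D) ^ n / D ^ (n - 2) :=
        div_le_div_of_nonneg_right (mul_le_mul (by norm_num) hprod
          (Finset.prod_nonneg fun _ _ => norm_nonneg _) zero_le_one) (pow_nonneg hD0 _)
    _ ≤ 2 ^ n * D ^ 2 := by rwa [one_mul]
    _ ≤ 2 ^ n * Real.exp |s| := by gcongr

/-- The function `F` is even. -/
lemma seifertF_neg {n : ℕ} (hn : 2 ≤ n) (p : Fin n → ℤ) (y : ℂ) :
    seifertF n p (-y) = seifertF n p y := by
  have hsign : ((-1 : ℂ)) ^ n = (-1) ^ (n - 2) := by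
    obtain ⟨m, rfl⟩ := Nat.exists_eq_add_of_le hn
    simp [pow_add]
  have hne : ((-1 : ℂ)) ^ (n - 2) ≠ 0 := pow_ne_zero _ (by norm_num)
  simp only [seifertF, neg_div, Complex.sinh_neg, Finset.prod_neg, Finset.card_univ,
    Fintype.card_fin]
  rw [neg_pow (Complex.sinh _), hsign, mul_left_comm, mul_div_mul_left _ _ hne]

/-- A measurable function of at most exponential growth is integrable against a Gaussian. -/
lemma integrable_mul_cexp_neg_mul_sq_of_norm_le_exp {f : ℝ → ℂ} (hf : Measurable f) {C b : ℝ}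
    (hb : 0 < b) (hfC : ∀ s, ‖f s‖ ≤ C * Real.exp |s|) :
    Integrable fun s : ℝ => f s * Complex.exp (-(b : ℂ) * (s : ℂ) ^ 2) := by
  have hC : 0 ≤ C := by simpa using (norm_nonneg _).trans (hfC 0)
  refine ((integrable_exp_neg_mul_sq (half_pos hb)).const_mul
    (C * Real.exp (1 / (2 * b)))).mono' (by fun_prop) (ae_of_all _ fun s => ?_)
  rw [norm_mul, norm_cexp_neg_mul_sq, Complex.ofReal_re]
  have hexp : |s| + -b * s ^ 2 ≤ 1 / (2 * b) + -(b / 2) * s ^ 2 := by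
    have h : 1 / (2 * b) + -(b / 2) * s ^ 2 - (|s| + -b * s ^ 2) = (b * |s| - 1) ^ 2 / (2 * b) := by
      rw [← sq_abs s]
      field_simp
      ring
    have : 0 ≤ (b * |s| - 1) ^ 2 / (2 * b) := by positivity
    linarith
  calc ‖f s‖ * Real.exp (-b * s ^ 2) ≤ C * Real.exp |s| * Real.exp (-b * s ^ 2) := by
        gcongr
        exact hfC s
    _ = C * Real.exp (|s| + -b * s ^ 2) := by rw [Real.exp_add, mul_assoc]
    _ ≤ C * Real.exp (1 / (2 * b) + -(b / 2) * s ^ 2) := by gcongr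
    _ = C * Real.exp (1 / (2 * b)) * Real.exp (-(b / 2) * s ^ 2) := by
        rw [Real.exp_add, mul_assoc]

/-- The integral of an even integrable function is twice the integral over the half-line. -/
lemma integral_eq_two_smul_integral_Ioi_of_even {E : Type*} [NormedAddCommGroup E]
    [NormedSpace ℝ E] {G : ℝ → E} (hG : Integrable G) (heven : ∀ s, G (-s) = G s) :
    ∫ s, G s = (2 : ℝ) • ∫ s in Set.Ioi (0 : ℝ), G s := by
  have hIic : ∫ s in Set.Iic (0 : ℝ), G s = ∫ s in Set.Ioi (0 : ℝ), G s := by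
    have h := integral_comp_neg_Ioi 0 G
    simp only [heven, neg_zero] at h
    exact h.symm
  rw [← intervalIntegral.integral_Iic_add_Ioi hG.integrableOn hG.integrableOn, hIic, two_smul]

/-- The substitution `s = √c * √t`, with the Jacobian written as in `integrableOn_comp_sqrt`. -/
lemma smul_comp_sqrt_eqOn {E : Type*} [AddCommGroup E] [Module ℝ E] (G : ℝ → E) {c : ℝ} :
    Set.EqOn (fun t : ℝ => (|(1 / 2 : ℝ)| * t ^ ((1 / 2 : ℝ) - 1)) •
        ((2 * √c) • G (√c * t ^ (1 / 2 : ℝ))))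
      (fun t : ℝ => (√c / √t) • G (√c * √t)) (Set.Ioi 0) := by
  intro t ht
  have ht0 : (0 : ℝ) < t := ht
  have ht1 : t ^ ((1 / 2 : ℝ) - 1) = (√t)⁻¹ := by
    rw [Real.sqrt_eq_rpow, ← Real.rpow_neg ht0.le]
    norm_num
  simp only [ht1, ← Real.sqrt_eq_rpow, smul_smul]
  congr 1
  rw [abs_of_pos (by norm_num : (0 : ℝ) < 1 / 2)]
  ring

/-- Integrability under the substitution `s = √c * √t`. -/
lemma integrableOn_comp_sqrt {E : Type*} [NormedAddCommGroup E] [NormedSpace ℝ E] {G : ℝ → E}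
    (hG : IntegrableOn G (Set.Ioi 0)) {c : ℝ} (hc : 0 < c) :
    IntegrableOn (fun t : ℝ => (√c / √t) • G (√c * √t)) (Set.Ioi 0) := by
  have hscaled : IntegrableOn (fun u : ℝ => (2 * √c) • G (√c * u)) (Set.Ioi 0) :=
    ((integrableOn_Ioi_comp_mul_left_iff G 0 (Real.sqrt_pos.2 hc)).2 (by simpa using hG)).smul _
  exact ((integrableOn_Ioi_comp_rpow_iff _ (by norm_num : (1 / 2 : ℝ) ≠ 0)).2 hscaled).congr_fun
    (smul_comp_sqrt_eqOn G) measurableSet_Ioi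

/-- The substitution `s = √c * √t` in the integral of an even function. -/
lemma integral_eq_integral_Ioi_comp_sqrt {E : Type*} [NormedAddCommGroup E] [NormedSpace ℝ E]
    {G : ℝ → E} (hG : Integrable G) (heven : ∀ s, G (-s) = G s) {c : ℝ} (hc : 0 < c) :
    ∫ s, G s = ∫ t in Set.Ioi (0 : ℝ), (√c / √t) • G (√c * √t) := by
  have hc' : 0 < √c := Real.sqrt_pos.2 hc
  rw [← setIntegral_congr_fun measurableSet_Ioi (smul_comp_sqrt_eqOn G),
    integral_comp_rpow_Ioi (fun u : ℝ => (2 * √c) • G (√c * u))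
      (by norm_num : (1 / 2 : ℝ) ≠ 0), integral_smul, integral_comp_mul_left_Ioi G 0 hc',
    integral_eq_two_smul_integral_Ioi_of_even hG heven, mul_zero, smul_smul, mul_assoc,
    mul_inv_cancel₀ hc'.ne', mul_one]

open Complex in
/-- The principal square root of `2 i x²` for `x > 0`. -/
lemma two_mul_I_mul_sq_cpow_half {x : ℝ} (hx : 0 < x) :
    (2 * I * (x : ℂ) ^ 2) ^ ((1 : ℂ) / 2) = (1 + I) * x := by
  have h : 2 * I * (x : ℂ) ^ 2 = ((1 + I) * x) ^ 2 := by
    linear_combination -(x : ℂ) ^ 2 * I_sq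
  rw [h, one_div]
  exact sq_cpow_two_inv (by simpa using hx)

theorem statement11 (n : ℕ) (hn : 3 ≤ n) (p : Fin n → ℤ)
    (hp2 : ∀ j, 2 ≤ p j)
    (hpcop : ∀ i j : Fin n, i ≠ j → IsCoprime (p i) (p j))
    (k : ℝ) (hk : 0 < k) :
    MeasureTheory.Integrable (fun s : ℝ =>
      seifertF n p ((1 + Complex.I) * (s : ℂ)) *
        Complex.exp (-(k : ℂ) * (s : ℂ) ^ 2 / (4 * (Real.pi : ℂ) * ((∏ j, p j : ℤ) : ℂ))) *
        (1 + Complex.I)) ∧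
    MeasureTheory.IntegrableOn (fun t : ℝ =>
      Complex.exp (-(k : ℂ) * (t : ℂ)) * (1 / (2 * (Real.pi : ℂ) * Complex.I)) *
        (8 * (Real.pi : ℂ) * Complex.I * ((∏ j, p j : ℤ) : ℂ) / (t : ℂ)) ^ ((1 : ℂ) / 2) *
        seifertF n p ((8 * (Real.pi : ℂ) * Complex.I * ((∏ j, p j : ℤ) : ℂ) * (t : ℂ)) ^
          ((1 : ℂ) / 2))) (Set.Ioi 0) ∧
    (1 / (2 * (Real.pi : ℂ) * Complex.I)) *
        (∫ s : ℝ,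
          seifertF n p ((1 + Complex.I) * (s : ℂ)) *
            Complex.exp (-(k : ℂ) * (s : ℂ) ^ 2 / (4 * (Real.pi : ℂ) * ((∏ j, p j : ℤ) : ℂ))) *
            (1 + Complex.I)) =
      ∫ t in Set.Ioi (0 : ℝ),
        Complex.exp (-(k : ℂ) * (t : ℂ)) * (1 / (2 * (Real.pi : ℂ) * Complex.I)) *
          (8 * (Real.pi : ℂ) * Complex.I * ((∏ j, p j : ℤ) : ℂ) / (t : ℂ)) ^ ((1 : ℂ) / 2) *
          seifertF n p ((8 * (Real.pi : ℂ) * Complex.I * ((∏ j, p j : ℤ) : ℂ) * (t : ℂ)) ^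
            ((1 : ℂ) / 2)) := by
  have hP : (0 : ℝ) < ((∏ j, p j : ℤ) : ℝ) := by
    exact_mod_cast Finset.prod_pos fun j _ => by linarith [hp2 j]
  have hPcast : ((∏ j, p j : ℤ) : ℂ) = (((∏ j, p j : ℤ) : ℝ) : ℂ) := by norm_cast
  rw [hPcast]
  generalize ((∏ j, p j : ℤ) : ℝ) = P at hP
  set G : ℝ → ℂ := fun s => seifertF n p ((1 + Complex.I) * (s : ℂ)) *
    Complex.exp (-(k : ℂ) * (s : ℂ) ^ 2 / (4 * (Real.pi : ℂ) * (P : ℂ))) * (1 + Complex.I) with hGdef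
  have hc : 0 < 4 * Real.pi * P := by positivity
  have hmeas : Measurable fun s : ℝ => seifertF n p ((1 + Complex.I) * (s : ℂ)) := by
    unfold seifertF
    fun_prop
  have hG : Integrable G := by
    refine ((integrable_mul_cexp_neg_mul_sq_of_norm_le_exp hmeas (div_pos hk hc) fun s =>
      norm_seifertF_le (by omega) (fun j => by linarith [hp2 j]) s).mul_const
        (1 + Complex.I)).congr (ae_of_all _ fun s => ?_)
    simp only [hGdef]
    congr 3
    push_cast
    ring
  have heven (s : ℝ) : G (-s) = G s := by
    simp only [hGdef, Complex.ofReal_neg, mul_neg, neg_sq, seifertF_neg (by omega : 2 ≤ n)]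
  have hsubst : Set.EqOn
      (fun t : ℝ => (1 / (2 * (Real.pi : ℂ) * Complex.I)) *
        ((√(4 * Real.pi * P) / √t) • G (√(4 * Real.pi * P) * √t)))
      (fun t : ℝ => Complex.exp (-(k : ℂ) * (t : ℂ)) * (1 / (2 * (Real.pi : ℂ) * Complex.I)) *
        (8 * (Real.pi : ℂ) * Complex.I * (P : ℂ) / (t : ℂ)) ^ ((1 : ℂ) / 2) *
        seifertF n p ((8 * (Real.pi : ℂ) * Complex.I * (P : ℂ) * (t : ℂ)) ^ ((1 : ℂ) / 2)))
      (Set.Ioi 0) := by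
    intro t ht
    have ht0 : (0 : ℝ) < t := ht
    have hsc : ((√(4 * Real.pi * P) : ℝ) : ℂ) ^ 2 = 4 * Real.pi * P := by
      exact_mod_cast Real.sq_sqrt hc.le
    have hst : ((√t : ℝ) : ℂ) ^ 2 = t := by exact_mod_cast Real.sq_sqrt ht0.le
    have hdiv : 8 * (Real.pi : ℂ) * Complex.I * (P : ℂ) / (t : ℂ) =
        2 * Complex.I * ((√(4 * Real.pi * P) / √t : ℝ) : ℂ) ^ 2 := by
      rw [Complex.ofReal_div, div_pow, hsc, hst]
      ring
    have hmul : 8 * (Real.pi : ℂ) * Complex.I * (P : ℂ) * (t : ℂ) =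
        2 * Complex.I * ((√(4 * Real.pi * P) * √t : ℝ) : ℂ) ^ 2 := by
      rw [Complex.ofReal_mul, mul_pow, hsc, hst]
      ring
    have hexp : -(k : ℂ) * ((√(4 * Real.pi * P) * √t : ℝ) : ℂ) ^ 2 /
        (4 * (Real.pi : ℂ) * (P : ℂ)) = -(k : ℂ) * t := by
      have hc' : 4 * (Real.pi : ℂ) * (P : ℂ) ≠ 0 := by exact_mod_cast hc.ne'
      rw [Complex.ofReal_mul, mul_pow, hsc, hst, mul_left_comm, mul_div_cancel_left₀ _ hc']
    simp only [hGdef]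
    rw [hdiv, hmul, two_mul_I_mul_sq_cpow_half (by positivity),
      two_mul_I_mul_sq_cpow_half (by positivity), hexp, Complex.real_smul]
    ring
  refine ⟨hG, ?_, ?_⟩
  · exact IntegrableOn.congr_fun ((integrableOn_comp_sqrt hG.integrableOn hc).const_mul _) hsubst
      measurableSet_Ioi
  · rw [integral_eq_integral_Ioi_comp_sqrt hG heven hc, ← integral_const_mul]
    exact setIntegral_congr_fun measurableSet_Ioi hsubst
end
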